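/- arXiv:math/0601247 — 3 statements merged into one kernel-verified Lean document; each statement's English description precedes it below -/
import Mathlib

section
/- (a) If r, x ∈ P ∖ p̄ are not parallel, then r ⊔ x = M ∖ p̄ for some circle M which either belongs to ⟨p,K⟩ or is tangent at r to some circle of ⟨p,K⟩. (b) If r, x ∈ P ∖ p̄ are distinct and parallel, then r ⊔ x ⊆ r̄. -/
/-- A Laguerre plane: points, circles, and a parallelity relation. -/
structure LaguerrePlane (P : Type*) where
  Circles : Set (Set P)
  Par : P → P → Prop
  par_equiv : Equivalence Par
  joinCircle : ∀ a b c : P, ¬ Par a b → ¬ Par b c → ¬ Par a c →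
    ∃! C, C ∈ Circles ∧ a ∈ C ∧ b ∈ C ∧ c ∈ C
  touching : ∀ K ∈ Circles, ∀ p ∈ K, ∀ q, q ∉ K → ¬ Par p q →
    ∃! C, C ∈ Circles ∧ q ∈ C ∧ K ∩ C = {p}
  parPoint : ∀ (x : P), ∀ K ∈ Circles, ∃! q, Par x q ∧ q ∈ K
  nontriv : ∃ C ∈ Circles,
    (∃ a b c : P, a ∈ C ∧ b ∈ C ∧ c ∈ C ∧ a ≠ b ∧ b ≠ c ∧ a ≠ c) ∧ C ≠ Set.univ

namespace LaguerrePlane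

variable {P : Type*}

/-- The generator (parallel class) of a point. -/
def gen (L : LaguerrePlane P) (p : P) : Set P := {q | L.Par p q}

/-- The pencil ⟨p,K⟩: the circle K together with all circles tangent to K at p. -/
def pencil (L : LaguerrePlane P) (p : P) (K : Set P) : Set (Set P) :=
  insert K {M | M ∈ L.Circles ∧ M ∩ K = {p}}

/-- An automorphism of a Laguerre plane: a bijection of the points mapping
circles onto circles and preserving parallelity. -/
def IsAut (L : LaguerrePlane P) (σ : Equiv.Perm P) : Prop :=
  (∀ C, C ∈ L.Circles ↔ ⇑σ '' C ∈ L.Circles) ∧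
  (∀ x y, L.Par x y ↔ L.Par (σ x) (σ y))

/-- The line x ⊔ y of the residual plane SA(p,K):
{x} together with the orbit of y under the stabilizer of x in Δ. -/
def line (Δ : Subgroup (Equiv.Perm P)) (x y : P) : Set P :=
  {x} ∪ {z | ∃ σ ∈ Δ, σ x = x ∧ σ y = z}

/-- Parallelity of lines of the residual plane SA(p,K). -/
def LinePar (Δ : Subgroup (Equiv.Perm P)) (A B : Set P) : Prop :=
  ∃ σ ∈ Δ, ⇑σ '' A = B

end LaguerrePlane

open LaguerrePlane

namespace LaguerrePlane

variable {P : Type*} {L : LaguerrePlane P}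

/-- A circle contains at most one point of each generator. -/
lemma eq_of_par_of_mem {C : Set P} (hC : C ∈ L.Circles) {a b : P}
    (ha : a ∈ C) (hb : b ∈ C) (h : L.Par a b) : a = b :=
  (L.parPoint a C hC).unique ⟨L.par_equiv.refl a, ha⟩ ⟨h, hb⟩

lemma mem_circles_of_mem_pencil {p : P} {K N : Set P} (hK : K ∈ L.Circles)
    (hN : N ∈ L.pencil p K) : N ∈ L.Circles := by
  rcases hN with rfl | ⟨h, -⟩
  exacts [hK, h]

/-- Two circles of a pencil sharing a point off the generator of the carrier coincide. -/
lemma pencil_unique {p r : P} {K M N : Set P} (hK : K ∈ L.Circles) (hpK : p ∈ K)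
    (hr : ¬ L.Par p r) (hM : M ∈ L.pencil p K) (hN : N ∈ L.pencil p K)
    (hrM : r ∈ M) (hrN : r ∈ N) : M = N := by
  have hrp : r ≠ p := by
    rintro rfl
    exact hr (L.par_equiv.refl _)
  have notMem : ∀ {C : Set P}, C ∩ K = {p} → r ∈ C → r ∉ K := fun {C} h hC hrK =>
    hrp (h.subset ⟨hC, hrK⟩)
  rcases hM with rfl | ⟨hM, hMK⟩ <;> rcases hN with rfl | ⟨hN, hNK⟩
  · rfl
  · exact absurd hrM (notMem hNK hrN)
  · exact absurd hrN (notMem hMK hrM)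
  · exact (L.touching K hK p hpK r (notMem hMK hrM) hr).unique
      ⟨hM, hrM, by rw [Set.inter_comm, hMK]⟩ ⟨hN, hrN, by rw [Set.inter_comm, hNK]⟩

/-- An automorphism fixing `p` preserves the complement of the generator of `p`. -/
lemma IsAut.par_apply_iff {σ : Equiv.Perm P} (hσ : L.IsAut σ) {p : P} (hp : σ p = p) (x : P) :
    L.Par p (σ x) ↔ L.Par p x := by
  rw [hσ.2 p x, hp]

/-- The stabilizer of `r` in `Δ` permutes transitively the generators other than
those of `p` and `r`. -/
lemma exists_stabilizer_par {p : P} {K : Set P} {Δ : Subgroup (Equiv.Perm P)}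
    (hK : K ∈ L.Circles) (hpK : p ∈ K)
    (haut : ∀ σ ∈ Δ, L.IsAut σ)
    (hfix : ∀ σ ∈ Δ, σ p = p)
    (hA1 : ∀ x y : P, ¬ L.Par p x → ¬ L.Par p y → ∃ σ ∈ Δ, σ x = y)
    (hA2 : ∀ r ∈ K, r ≠ p → ∀ x ∈ K, x ≠ p → x ≠ r → ∀ y ∈ K, y ≠ p → y ≠ r →
      ∃ σ ∈ Δ, σ r = r ∧ σ x = y)
    {r x y : P} (hr : ¬ L.Par p r) (hx : ¬ L.Par p x) (hy : ¬ L.Par p y)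
    (hrx : ¬ L.Par r x) (hry : ¬ L.Par r y) :
    ∃ τ ∈ Δ, τ r = r ∧ L.Par (τ x) y := by
  obtain ⟨r₀, ⟨hrr₀, hr₀K⟩, -⟩ := L.parPoint r K hK
  have hr₀ : ¬ L.Par p r₀ := fun h => hr (L.par_equiv.trans h (L.par_equiv.symm hrr₀))
  obtain ⟨σ, hσ, rfl⟩ := hA1 r r₀ hr hr₀
  have hσa := haut σ hσ
  have foot : ∀ z, ¬ L.Par p z → ¬ L.Par r z →
      ∃ z₀ ∈ K, L.Par (σ z) z₀ ∧ z₀ ≠ p ∧ z₀ ≠ σ r := by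
    intro z hz hrz
    obtain ⟨z₀, ⟨hzz₀, hz₀K⟩, -⟩ := L.parPoint (σ z) K hK
    refine ⟨z₀, hz₀K, hzz₀, ?_, ?_⟩
    · rintro rfl
      exact hz ((hσa.par_apply_iff (hfix σ hσ) z).1 (L.par_equiv.symm hzz₀))
    · rintro rfl
      exact hrz ((hσa.2 r z).2 (L.par_equiv.symm hzz₀))
  obtain ⟨x₀, hx₀K, hxx₀, hx₀p, hx₀r⟩ := foot x hx hrx
  obtain ⟨y₀, hy₀K, hyy₀, hy₀p, hy₀r⟩ := foot y hy hry
  have hr₀p : σ r ≠ p := by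
    intro h
    rw [h] at hr₀
    exact hr₀ (L.par_equiv.refl p)
  obtain ⟨ρ, hρ, hρr, hρx⟩ := hA2 (σ r) hr₀K hr₀p x₀ hx₀K hx₀p hx₀r y₀ hy₀K hy₀p hy₀r
  refine ⟨σ⁻¹ * ρ * σ, Δ.mul_mem (Δ.mul_mem (Δ.inv_mem hσ) hρ) hσ, ?_, ?_⟩
  · simp [hρr]
  · have h : L.Par (ρ (σ x)) y₀ := hρx ▸ ((haut ρ hρ).2 _ _).1 hxx₀
    rw [hσa.2]
    simpa using L.par_equiv.trans h (L.par_equiv.symm hyy₀)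

/-- If the stabilizer of `r` in `Δ` leaves invariant a circle `M` joining `r` and `x`, and is
transitive on the generators other than those of `p` and `r`, then `r ⊔ x` is the affine part
of `M`. -/
lemma line_eq_of_invariant {p r x : P} {M : Set P} {Δ : Subgroup (Equiv.Perm P)}
    (haut : ∀ σ ∈ Δ, L.IsAut σ)
    (hfix : ∀ σ ∈ Δ, σ p = p)
    (htrans : ∀ y, ¬ L.Par p y → ¬ L.Par r y → ∃ τ ∈ Δ, τ r = r ∧ L.Par (τ x) y)
    (hM : M ∈ L.Circles) (hr : ¬ L.Par p r) (hx : ¬ L.Par p x)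
    (hrM : r ∈ M) (hxM : x ∈ M)
    (hinv : ∀ τ ∈ Δ, τ r = r → ⇑τ '' M = M) :
    line Δ r x = M \ L.gen p := by
  have hτM : ∀ τ ∈ Δ, τ r = r → τ x ∈ M := fun τ hτ hτr =>
    (hinv τ hτ hτr).subset (Set.mem_image_of_mem _ hxM)
  apply Set.Subset.antisymm
  · rintro z (rfl | ⟨τ, hτ, hτr, rfl⟩)
    · exact ⟨hrM, hr⟩
    · exact ⟨hτM τ hτ hτr, fun h => hx (((haut τ hτ).par_apply_iff (hfix τ hτ) x).1 h)⟩
  · rintro y ⟨hyM, hy⟩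
    by_cases hry : L.Par r y
    · exact Or.inl (eq_of_par_of_mem hM hrM hyM hry).symm
    · obtain ⟨τ, hτ, hτr, hτx⟩ := htrans y hy hry
      exact Or.inr ⟨τ, hτ, hτr, eq_of_par_of_mem hM (hτM τ hτ hτr) hyM hτx⟩

end LaguerrePlane

/-- (a) if r, x ∈ P∖p̄ are nonparallel then r ⊔ x = M ∖ p̄ for a
circle M which belongs to ⟨p,K⟩ or is tangent at r to some circle of ⟨p,K⟩;
(b) if r, x ∈ P∖p̄ are distinct and parallel then r ⊔ x ⊆ r̄. -/
theorem line_is_circle_or_in_generator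
    {P : Type*} (L : LaguerrePlane P) (p : P) (K : Set P)
    (Δ : Subgroup (Equiv.Perm P))
    (hK : K ∈ L.Circles) (hpK : p ∈ K)
    (haut : ∀ σ ∈ Δ, L.IsAut σ)
    (hfix : ∀ σ ∈ Δ, ∀ q, L.Par p q → σ q = q)
    (hpen : ∀ σ ∈ Δ, ∀ M ∈ L.pencil p K, ⇑σ '' M ∈ L.pencil p K)
    (hA1 : ∀ x y : P, ¬ L.Par p x → ¬ L.Par p y → ∃ σ ∈ Δ, σ x = y)
    (hA2 : ∀ r ∈ K, r ≠ p → ∀ x ∈ K, x ≠ p → x ≠ r → ∀ y ∈ K, y ≠ p → y ≠ r →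
      ∃ σ ∈ Δ, σ r = r ∧ σ x = y)    :
    (∀ r x : P, ¬ L.Par p r → ¬ L.Par p x → ¬ L.Par r x →
      ∃ M ∈ L.Circles,
        (M ∈ L.pencil p K ∨ ∃ N ∈ L.pencil p K, M ∩ N = {r}) ∧
        line Δ r x = M \ L.gen p) ∧
    (∀ r x : P, ¬ L.Par p r → ¬ L.Par p x → r ≠ x → L.Par r x →
      line Δ r x ⊆ L.gen r) := by
  have hfixp : ∀ σ ∈ Δ, σ p = p := fun σ hσ => hfix σ hσ p (L.par_equiv.refl p)
  refine ⟨fun r x hr hx hrx => ?_, ?_⟩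
  · obtain ⟨r₀, ⟨hrr₀, hr₀K⟩, -⟩ := L.parPoint r K hK
    obtain ⟨σ, hσ, hσr⟩ := hA1 r₀ r
      (fun h => hr (L.par_equiv.trans h (L.par_equiv.symm hrr₀))) hr
    obtain ⟨N, hN, hrN⟩ : ∃ N ∈ L.pencil p K, r ∈ N :=
      ⟨σ '' K, hpen σ hσ K (Set.mem_insert _ _), r₀, hr₀K, hσr⟩
    have hNC := mem_circles_of_mem_pencil hK hN
    have hNinv : ∀ τ ∈ Δ, τ r = r → ⇑τ '' N = N := fun τ hτ hτr =>
      pencil_unique hK hpK hr (hpen τ hτ N hN) hN ⟨r, hrN, hτr⟩ hrN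
    have htrans : ∀ y, ¬ L.Par p y → ¬ L.Par r y → ∃ τ ∈ Δ, τ r = r ∧ L.Par (τ x) y :=
      fun y hy hry => exists_stabilizer_par hK hpK haut hfixp hA1 hA2 hr hx hy hrx hry
    by_cases hxN : x ∈ N
    · exact ⟨N, hNC, Or.inl hN,
        line_eq_of_invariant haut hfixp htrans hNC hr hx hrN hxN hNinv⟩
    · obtain ⟨M, ⟨hM, hxM, hNM⟩, -⟩ := L.touching N hNC r hrN x hxN hrx
      have hrM : r ∈ M := (hNM.symm.subset rfl).2
      refine ⟨M, hM, Or.inr ⟨N, hN, by rw [Set.inter_comm, hNM]⟩,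
        line_eq_of_invariant haut hfixp htrans hM hr hx hrM hxM fun τ hτ hτr => ?_⟩
      obtain ⟨q, ⟨hpq, hqM⟩, -⟩ := L.parPoint p M hM
      have hqN : q ∉ N := by
        intro h
        have hqr : q = r := hNM.subset ⟨h, hqM⟩
        exact hr (hqr ▸ hpq)
      have hrq : ¬ L.Par r q := fun h => hr (L.par_equiv.trans hpq (L.par_equiv.symm h))
      refine (L.touching N hNC r hrN q hqN hrq).unique
        ⟨((haut τ hτ).1 M).1 hM, ⟨q, hqM, hfix τ hτ q hpq⟩, ?_⟩ ⟨hM, hqM, hNM⟩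
      rw [← hNinv τ hτ hτr, ← Set.image_inter τ.injective, hNM, Set.image_singleton, hτr]
  · rintro r x - - - hrx z (rfl | ⟨σ, hσ, hσr, rfl⟩)
    · exact L.par_equiv.refl _
    · exact ((haut σ hσ).par_apply_iff hσr x).2 hrx
end

section
/- Assume (A3). If M is a circle with p ∉ M, x is the base point of M, and y ∈ M with y ≠ x and y ≠ pM, then x ⊔ y = M ∖ p̄; in particular M ∖ p̄ is a line of SA(p,K) with basepoint x. -/
open LaguerrePlane

namespace LaguerrePlane

variable {P : Type*} {L : LaguerrePlane P} {p x : P} {K M N N₂ : Set P}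
  {Δ : Subgroup (Equiv.Perm P)}

/-- Parallel points on a common circle coincide. -/
theorem eq_of_par (hK : K ∈ L.Circles) {a b : P} (ha : a ∈ K) (hb : b ∈ K)
    (hab : L.Par a b) : a = b :=
  (L.parPoint a K hK).unique ⟨L.par_equiv.refl a, ha⟩ ⟨hab, hb⟩

theorem circle_of_mem_pencil (hK : K ∈ L.Circles) (hN : N ∈ L.pencil p K) :
    N ∈ L.Circles := by
  rcases hN with rfl | hN
  exacts [hK, hN.1]

theorem mem_of_mem_pencil (hpK : p ∈ K) (hN : N ∈ L.pencil p K) : p ∈ N := by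
  rcases hN with rfl | hN
  · exact hpK
  · exact (hN.2.symm ▸ Set.mem_singleton p : p ∈ N ∩ K).1

/-- At most one circle of a pencil passes through a given point not parallel to its carrier. -/
theorem pencil_unique_s3 (hK : K ∈ L.Circles) (hpK : p ∈ K) (hx : ¬ L.Par p x)
    (hN : N ∈ L.pencil p K) (hN₂ : N₂ ∈ L.pencil p K) (hxN : x ∈ N) (hxN₂ : x ∈ N₂) :
    N = N₂ := by
  have key : ∀ A ∈ L.Circles, A ∩ K = {p} → x ∈ A → x ∉ K := by
    intro A _ h hA hxK
    have : x ∈ A ∩ K := ⟨hA, hxK⟩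
    rw [h] at this
    exact hx (this ▸ L.par_equiv.refl _)
  rcases hN with rfl | ⟨hN, hNK⟩ <;> rcases hN₂ with rfl | ⟨hN₂, hNK₂⟩
  · rfl
  · exact absurd hxN (key _ hN₂ hNK₂ hxN₂)
  · exact absurd hxN₂ (key _ hN hNK hxN)
  · exact (L.touching K hK p hpK x (key _ hN hNK hxN) hx).unique
      ⟨hN, hxN, by rw [Set.inter_comm, hNK]⟩ ⟨hN₂, hxN₂, by rw [Set.inter_comm, hNK₂]⟩

/-- The base point of a circle missing `p` is not parallel to `p`. -/
theorem not_par_base (hK : K ∈ L.Circles) (hpK : p ∈ K) (hpM : p ∉ M)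
    (hN : N ∈ L.pencil p K) (hMN : M ∩ N = {x}) : ¬ L.Par p x := by
  have hx : x ∈ M ∩ N := hMN.symm ▸ Set.mem_singleton x
  intro h
  have := eq_of_par (circle_of_mem_pencil hK hN) (mem_of_mem_pencil hpK hN) hx.2 h
  exact hpM (this ▸ hx.1)

/-- A circle missing `p` is invariant under the stabilizer of its base point. -/
theorem image_eq_of_fix_base (hK : K ∈ L.Circles) (hpK : p ∈ K)
    (haut : ∀ σ ∈ Δ, L.IsAut σ) (hfix : ∀ σ ∈ Δ, ∀ q, L.Par p q → σ q = q)
    (hpen : ∀ σ ∈ Δ, ∀ M ∈ L.pencil p K, ⇑σ '' M ∈ L.pencil p K)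
    (hM : M ∈ L.Circles) (hpM : p ∉ M) (hN : N ∈ L.pencil p K) (hMN : M ∩ N = {x})
    {σ : Equiv.Perm P} (hσ : σ ∈ Δ) (hσx : σ x = x) : ⇑σ '' M = M := by
  have hx : x ∈ M ∩ N := hMN.symm ▸ Set.mem_singleton x
  have hpx := not_par_base hK hpK hpM hN hMN
  have hσN : ⇑σ '' N = N :=
    pencil_unique_s3 hK hpK hpx (hpen σ hσ N hN) hN ⟨x, hx.2, hσx⟩ hx.2
  obtain ⟨q, ⟨hpq, hqM⟩, -⟩ := L.parPoint p M hM
  have hqN : q ∉ N := fun h => hpM <|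
    (eq_of_par (circle_of_mem_pencil hK hN) (mem_of_mem_pencil hpK hN) h hpq).symm ▸ hqM
  have hxq : ¬ L.Par x q := fun h =>
    hpx (L.par_equiv.trans hpq (L.par_equiv.symm h))
  refine (L.touching N (circle_of_mem_pencil hK hN) x hx.2 q hqN hxq).unique
    ⟨((haut σ hσ).1 M).1 hM, ⟨q, hqM, hfix σ hσ q hpq⟩, ?_⟩
    ⟨hM, hqM, by rw [Set.inter_comm, hMN]⟩
  calc N ∩ ⇑σ '' M = ⇑σ '' N ∩ ⇑σ '' M := by rw [hσN]
    _ = ⇑σ '' (M ∩ N) := by rw [← Set.image_inter σ.injective, Set.inter_comm]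
    _ = {x} := by rw [hMN, Set.image_singleton, hσx]

/-- An automorphism fixing `p` preserves being parallel to `p`. -/
theorem IsAut.par_iff {σ : Equiv.Perm P} (hσ : L.IsAut σ) (hp : σ p = p) (y : P) :
    L.Par p (σ y) ↔ L.Par p y := by
  rw [hσ.2 p y, hp]

end LaguerrePlane

/-- assume (A3).  If M is a circle with p ∉ M, x is the base point
of M (the point of tangency of M with the unique circle of ⟨p,K⟩ tangent to M)
and y ∈ M with y ≠ x and y ≠ pM, then x ⊔ y = M ∖ p̄. -/
theorem circle_is_line_with_basepoint
    {P : Type*} (L : LaguerrePlane P) (p : P) (K : Set P)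
    (Δ : Subgroup (Equiv.Perm P))
    (hK : K ∈ L.Circles) (hpK : p ∈ K)
    (haut : ∀ σ ∈ Δ, L.IsAut σ)
    (hfix : ∀ σ ∈ Δ, ∀ q, L.Par p q → σ q = q)
    (hpen : ∀ σ ∈ Δ, ∀ M ∈ L.pencil p K, ⇑σ '' M ∈ L.pencil p K)
    (hA1 : ∀ x y : P, ¬ L.Par p x → ¬ L.Par p y → ∃ σ ∈ Δ, σ x = y)
    (hA2 : ∀ r ∈ K, r ≠ p → ∀ x ∈ K, x ≠ p → x ≠ r → ∀ y ∈ K, y ≠ p → y ≠ r →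
      ∃ σ ∈ Δ, σ r = r ∧ σ x = y)    (hA3 : ∀ M ∈ L.Circles, p ∉ M → ∃! N, N ∈ L.pencil p K ∧ ∃ z, M ∩ N = {z})    :
    ∀ M ∈ L.Circles, p ∉ M →
    ∀ x : P, (∃ N ∈ L.pencil p K, M ∩ N = {x}) →
    ∀ y ∈ M, y ≠ x → ¬ L.Par p y →
      line Δ x y = M \ L.gen p := by
  intro M hM hpM x ⟨N, hN, hMN⟩ y hyM hyx hpy
  have hx : x ∈ M ∩ N := hMN.symm ▸ Set.mem_singleton x
  have hpx := not_par_base hK hpK hpM hN hMN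
  have hp : ∀ σ ∈ Δ, σ p = p := fun σ hσ => hfix σ hσ p (L.par_equiv.refl p)
  ext z
  constructor
  · rintro (rfl | ⟨σ, hσ, hσx, rfl⟩)
    · exact ⟨hx.1, hpx⟩
    · have h := image_eq_of_fix_base hK hpK haut hfix hpen hM hpM hN hMN hσ hσx
      exact ⟨h ▸ Set.mem_image_of_mem σ hyM,
        fun hz => hpy (((haut σ hσ).par_iff (hp σ hσ) y).1 hz)⟩
  · rintro ⟨hzM, hpz⟩
    by_cases hzx : z = x
    · exact Or.inl hzx
    right
    obtain ⟨r, ⟨hxr, hrK⟩, -⟩ := L.parPoint x K hK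
    have hpr : ¬ L.Par p r := fun h => hpx (L.par_equiv.trans h (L.par_equiv.symm hxr))
    obtain ⟨τ, hτ, hτx⟩ := hA1 x r hpx hpr
    have hτM : ⇑τ '' M ∈ L.Circles := ((haut τ hτ).1 M).1 hM
    have hpτM : p ∉ ⇑τ '' M := by
      rintro ⟨q, hq, hqp⟩
      exact hpM (τ.injective (hqp.trans (hp τ hτ).symm) ▸ hq)
    have hτMN : ⇑τ '' M ∩ ⇑τ '' N = {r} := by
      rw [← Set.image_inter τ.injective, hMN, Set.image_singleton, hτx]
    have hrτM : r ∈ ⇑τ '' M := ⟨x, hx.1, hτx⟩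
    have proj : ∀ w ∈ M, w ≠ x → ¬ L.Par p w →
        ∃ k ∈ K, k ≠ p ∧ k ≠ r ∧ L.Par (τ w) k := by
      intro w hw hwx hpw
      obtain ⟨k, ⟨hk, hkK⟩, -⟩ := L.parPoint (τ w) K hK
      refine ⟨k, hkK, ?_, ?_, hk⟩
      · rintro rfl
        exact hpw (((haut τ hτ).par_iff (hp τ hτ) w).1 (L.par_equiv.symm hk))
      · rintro rfl
        exact hwx (τ.injective ((eq_of_par hτM ⟨w, hw, rfl⟩ hrτM hk).trans hτx.symm))
    obtain ⟨k, hkK, hkp, hkr, hyk⟩ := proj y hyM hyx hpy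
    obtain ⟨l, hlK, hlp, hlr, hzl⟩ := proj z hzM hzx hpz
    have hrp : r ≠ p := fun h => hpr (h ▸ L.par_equiv.refl r)
    obtain ⟨ρ, hρ, hρr, hρk⟩ := hA2 r hrK hrp k hkK hkp hkr l hlK hlp hlr
    have hρM := image_eq_of_fix_base hK hpK haut hfix hpen hτM hpτM (hpen τ hτ N hN)
      hτMN hρ hρr
    have hρy : ρ (τ y) ∈ ⇑τ '' M := hρM ▸ Set.mem_image_of_mem ρ ⟨y, hyM, rfl⟩
    have hpar : L.Par (ρ (τ y)) (τ z) :=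
      L.par_equiv.trans (hρk ▸ ((haut ρ hρ).2 _ _).1 hyk) (L.par_equiv.symm hzl)
    have hyz : ρ (τ y) = τ z := eq_of_par hτM hρy ⟨z, hzM, rfl⟩ hpar
    refine ⟨τ⁻¹ * ρ * τ, Δ.mul_mem (Δ.mul_mem (Δ.inv_mem hτ) hρ) hτ, ?_, ?_⟩
    · rw [Equiv.Perm.mul_apply, Equiv.Perm.mul_apply, hτx, hρr, Equiv.Perm.inv_eq_iff_eq, hτx]
    · rw [Equiv.Perm.mul_apply, Equiv.Perm.mul_apply, hyz, Equiv.Perm.inv_eq_iff_eq]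
end

section
/- Assume (A3). For every circle R ∈ ⟨p,K⟩ and all distinct x, y ∈ R ∖ {p} there exist a point r ∈ R and an involution φ ∈ Δ such that φ fixes every point of r̄ and every point of p̄, maps K onto itself, and φ(x) = y. -/
open LaguerrePlane

namespace LaguerrePlane

variable {P : Type*}

theorem eq_of_par_s8 (L : LaguerrePlane P) {C : Set P} (hC : C ∈ L.Circles) {a b : P}
    (ha : a ∈ C) (hb : b ∈ C) (h : L.Par a b) : a = b :=
  (L.parPoint a C hC).unique ⟨L.par_equiv.refl a, ha⟩ ⟨h, hb⟩

theorem not_par (L : LaguerrePlane P) {C : Set P} (hC : C ∈ L.Circles) {a b : P}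
    (ha : a ∈ C) (hb : b ∈ C) (h : a ≠ b) : ¬ L.Par a b :=
  fun hp => h (L.eq_of_par_s8 hC ha hb hp)

theorem circle_mem_of_pencil (L : LaguerrePlane P) {p : P} {K : Set P} (hK : K ∈ L.Circles)
    {N : Set P} (hN : N ∈ L.pencil p K) : N ∈ L.Circles := by
  rcases hN with rfl | hN
  exacts [hK, hN.1]

theorem mem_of_pencil (L : LaguerrePlane P) {p : P} {K : Set P} (hpK : p ∈ K)
    {N : Set P} (hN : N ∈ L.pencil p K) : p ∈ N := by
  rcases hN with rfl | hN
  · exact hpK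
  · have : p ∈ N ∩ K := hN.2 ▸ Set.mem_singleton p
    exact this.1

theorem exists_pencil_mem (L : LaguerrePlane P) {p : P} {K : Set P} (hK : K ∈ L.Circles)
    (hpK : p ∈ K) {x : P} (hx : ¬ L.Par p x) : ∃ N ∈ L.pencil p K, x ∈ N := by
  by_cases hxK : x ∈ K
  · exact ⟨K, Or.inl rfl, hxK⟩
  · obtain ⟨C, ⟨hC, hxC, hKC⟩, -⟩ := L.touching K hK p hpK x hxK hx
    exact ⟨C, Or.inr ⟨hC, by rw [Set.inter_comm, hKC]⟩, hxC⟩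

theorem pencil_eq_of_mem (L : LaguerrePlane P) {p : P} {K : Set P} (hK : K ∈ L.Circles)
    (hpK : p ∈ K) {x : P} (hx : x ≠ p) {M N : Set P} (hM : M ∈ L.pencil p K)
    (hN : N ∈ L.pencil p K) (hxM : x ∈ M) (hxN : x ∈ N) : M = N := by
  have key : ∀ {A : Set P}, A ∩ K = {p} → x ∈ A → x ∉ K := fun hA hxA hxK =>
    hx (hA.subset ⟨hxA, hxK⟩)
  have hpx : ¬ L.Par p x :=
    L.not_par (L.circle_mem_of_pencil hK hM) (L.mem_of_pencil hpK hM) hxM hx.symm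
  rcases hM with rfl | hM <;> rcases hN with rfl | hN
  · rfl
  · exact absurd hxM (key hN.2 hxN)
  · exact absurd hxN (key hM.2 hxM)
  · exact (L.touching K hK p hpK x (key hM.2 hxM) hpx).unique
      ⟨hM.1, hxM, by rw [Set.inter_comm, hM.2]⟩ ⟨hN.1, hxN, by rw [Set.inter_comm, hN.2]⟩

theorem exists_par_ne (L : LaguerrePlane P) {R : Set P} (hR : R ∈ L.Circles) {p x y : P}
    (hp : p ∈ R) (hx : x ∈ R) (hy : y ∈ R) (hxp : x ≠ p) (hyp : y ≠ p) (hxy : x ≠ y) :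
    ∃ q, L.Par p q ∧ q ≠ p := by
  obtain ⟨w, hw⟩ : ∃ w, w ∉ R := by
    obtain ⟨C, hC, -, hCu⟩ := L.nontriv
    obtain ⟨w, hw⟩ := (Set.ne_univ_iff_exists_notMem C).1 hCu
    obtain ⟨v, ⟨hwv, hv⟩, -⟩ := L.parPoint w C hC
    by_contra! h
    exact hw (L.eq_of_par_s8 hR (h w) (h v) hwv ▸ hv)
  have key : ∀ z ∈ R, z ≠ p → ¬ L.Par z w → ∃ q, L.Par p q ∧ q ≠ p := by
    intro z hz hzp hzw
    obtain ⟨C, ⟨hC, -, hRC⟩, -⟩ := L.touching R hR z hz w hw hzw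
    obtain ⟨q, ⟨hpq, hq⟩, -⟩ := L.parPoint p C hC
    refine ⟨q, hpq, ?_⟩
    rintro rfl
    exact hzp (hRC.subset ⟨hp, hq⟩).symm
  by_cases hxw : L.Par x w
  · refine key y hy hyp fun hyw => ?_
    exact L.not_par hR hx hy hxy (L.par_equiv.trans hxw (L.par_equiv.symm hyw))
  · exact key x hx hxp hxw

/-- The fixed pencil `⟨p, K⟩` with the group `Δ` fixing `p̄` pointwise, satisfying transitivity
on points (A1) and on pairs of points of `K` (A2); the plane has a second point on `p̄`. -/
structure PencilGroup (L : LaguerrePlane P) (p : P) (K : Set P)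
    (Δ : Subgroup (Equiv.Perm P)) : Prop where
  circle : K ∈ L.Circles
  mem : p ∈ K
  aut : ∀ σ ∈ Δ, L.IsAut σ
  fix : ∀ σ ∈ Δ, ∀ q, L.Par p q → σ q = q
  pen : ∀ σ ∈ Δ, ∀ M ∈ L.pencil p K, ⇑σ '' M ∈ L.pencil p K
  trans : ∀ x y : P, ¬ L.Par p x → ¬ L.Par p y → ∃ σ ∈ Δ, σ x = y
  trans₂ : ∀ r ∈ K, r ≠ p → ∀ x ∈ K, x ≠ p → x ≠ r → ∀ y ∈ K, y ≠ p → y ≠ r →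
    ∃ σ ∈ Δ, σ r = r ∧ σ x = y
  exists_ne : ∃ q, L.Par p q ∧ q ≠ p

namespace PencilGroup

variable {L : LaguerrePlane P} {p : P} {K : Set P} {Δ : Subgroup (Equiv.Perm P)}

theorem not_par_of_mem (h : L.PencilGroup p K Δ) {N : Set P} (hN : N ∈ L.pencil p K) {x : P}
    (hx : x ∈ N) (hxp : x ≠ p) : ¬ L.Par p x :=
  L.not_par (L.circle_mem_of_pencil h.circle hN) (L.mem_of_pencil h.mem hN) hx hxp.symm

theorem map_ne (h : L.PencilGroup p K Δ) {σ : Equiv.Perm P} (hσ : σ ∈ Δ) {x : P}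
    (hx : x ≠ p) : σ x ≠ p := by
  rw [← h.fix σ hσ p (L.par_equiv.refl p)]
  exact σ.injective.ne hx

theorem image_eq (h : L.PencilGroup p K Δ) {σ : Equiv.Perm P} (hσ : σ ∈ Δ) {N : Set P}
    (hN : N ∈ L.pencil p K) {x : P} (hx : x ∈ N) (hxp : x ≠ p) (hσx : σ x ∈ N) :
    ⇑σ '' N = N :=
  L.pencil_eq_of_mem h.circle h.mem (h.map_ne hσ hxp) (h.pen σ hσ N hN) hN ⟨x, hx, rfl⟩ hσx

/-- The stabilizer of `r` fixes every circle tangent at `r` to the pencil circle through `r`. -/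
theorem image_eq_of_tangent (h : L.PencilGroup p K Δ) {σ : Equiv.Perm P} (hσ : σ ∈ Δ)
    {N M : Set P} (hN : N ∈ L.pencil p K) (hM : M ∈ L.Circles) {r : P} (hrp : r ≠ p)
    (hNM : N ∩ M = {r}) (hσr : σ r = r) : ⇑σ '' M = M := by
  have hr : r ∈ N ∩ M := hNM ▸ Set.mem_singleton r
  have hpr := h.not_par_of_mem hN hr.1 hrp
  obtain ⟨q, ⟨hpq, hqM⟩, -⟩ := L.parPoint p M hM
  have hqN : q ∉ N := fun hqN => hpr ((hNM.subset ⟨hqN, hqM⟩ : q = r) ▸ hpq)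
  have hrq : ¬ L.Par r q := fun hrq => hpr (L.par_equiv.trans hpq (L.par_equiv.symm hrq))
  refine (L.touching N (L.circle_mem_of_pencil h.circle hN) r hr.1 q hqN hrq).unique
    ⟨((h.aut σ hσ).1 M).1 hM, ⟨q, hqM, h.fix σ hσ q hpq⟩, ?_⟩ ⟨hM, hqM, hNM⟩
  conv_lhs => rw [← h.image_eq hσ hN hr.1 hrp (hσr.symm ▸ hr.1)]
  rw [← Set.image_inter σ.injective, hNM, Set.image_singleton, hσr]

theorem fix_of_par (h : L.PencilGroup p K Δ) {σ : Equiv.Perm P} (hσ : σ ∈ Δ)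
    {C : Set P} (hC : C ∈ L.Circles) (hσC : ⇑σ '' C = C) {s w : P} (hσs : σ s = s)
    (hsw : L.Par s w) (hw : w ∈ C) : σ w = w := by
  have h1 : σ w ∈ C := hσC ▸ ⟨w, hw, rfl⟩
  have h2 : L.Par (σ s) (σ w) := ((h.aut σ hσ).2 s w).1 hsw
  rw [hσs] at h2
  exact L.eq_of_par_s8 hC h1 hw (L.par_equiv.trans (L.par_equiv.symm h2) hsw)

theorem fix_gen (h : L.PencilGroup p K Δ) {σ : Equiv.Perm P} (hσ : σ ∈ Δ) {N : Set P}
    (hN : N ∈ L.pencil p K) {r s : P} (hr : r ∈ N) (hs : s ∈ N) (hrp : r ≠ p)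
    (hrs : r ≠ s) (hσr : σ r = r) (hσs : σ s = s) {w : P} (hsw : L.Par s w) : σ w = w := by
  have hNc := L.circle_mem_of_pencil h.circle hN
  by_cases hw : w ∈ N
  · rwa [← L.eq_of_par_s8 hNc hs hw hsw]
  · have hrw : ¬ L.Par r w := fun hrw =>
      L.not_par hNc hr hs hrs (L.par_equiv.trans hrw (L.par_equiv.symm hsw))
    obtain ⟨M, ⟨hM, hwM, hNM⟩, -⟩ := L.touching N hNc r hr w hw hrw
    exact h.fix_of_par hσ hM (h.image_eq_of_tangent hσ hN hM hrp hNM hσr) hσs hsw hwM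

theorem eq_one_of_fix (h : L.PencilGroup p K Δ) {σ : Equiv.Perm P} (hσ : σ ∈ Δ) {r s : P}
    (hr : ¬ L.Par p r) (hs : ¬ L.Par p s) (hrs : ¬ L.Par r s) (hσr : σ r = r)
    (hσs : σ s = s) : σ = 1 := by
  have hp1 := L.par_equiv.refl
  obtain ⟨N, hN, hrN⟩ := L.exists_pencil_mem h.circle h.mem hr
  have hNc := L.circle_mem_of_pencil h.circle hN
  have hrp : r ≠ p := by rintro rfl; exact hr (hp1 r)
  have hσN := h.image_eq hσ hN hrN hrp (hσr.symm ▸ hrN)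
  obtain ⟨t, ⟨hst, htN⟩, -⟩ := L.parPoint s N hNc
  have hσt := h.fix_of_par hσ hNc hσN hσs hst htN
  have htp : t ≠ p := by rintro rfl; exact hs (L.par_equiv.symm hst)
  have hrt : r ≠ t := by rintro rfl; exact hrs (L.par_equiv.symm hst)
  have hpt := h.not_par_of_mem hN htN htp
  have hrt' := L.not_par hNc hrN htN hrt
  have hcirc : ∀ C ∈ L.Circles, ⇑σ '' C = C := by
    intro C hC
    obtain ⟨a, ⟨hpa, haC⟩, -⟩ := L.parPoint p C hC
    obtain ⟨b, ⟨hrb, hbC⟩, -⟩ := L.parPoint r C hC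
    obtain ⟨c, ⟨htc, hcC⟩, -⟩ := L.parPoint t C hC
    have lift : ∀ {u v u' v' : P}, L.Par u u' → L.Par v v' → ¬ L.Par u v → ¬ L.Par u' v' :=
      fun h1 h2 h3 h4 => h3 (L.par_equiv.trans h1 (L.par_equiv.trans h4 (L.par_equiv.symm h2)))
    refine (L.joinCircle a b c (lift hpa hrb hr) (lift hrb htc hrt')
      (lift hpa htc hpt)).unique ⟨((h.aut σ hσ).1 C).1 hC, ⟨a, haC, h.fix σ hσ a hpa⟩,
        ⟨b, hbC, h.fix_gen hσ hN htN hrN htp hrt.symm hσt hσr hrb⟩,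
        ⟨c, hcC, h.fix_gen hσ hN hrN htN hrp hrt hσr hσt htc⟩⟩ ⟨hC, haC, hbC, hcC⟩
  ext w
  change σ w = w
  by_cases hpw : L.Par p w
  · exact h.fix σ hσ w hpw
  obtain ⟨W, hW, hwW⟩ := L.exists_pencil_mem h.circle h.mem hpw
  have hWc := L.circle_mem_of_pencil h.circle hW
  obtain ⟨q, hpq, hqp⟩ := h.exists_ne
  have hqW : q ∉ W := fun hq =>
    hqp (L.eq_of_par_s8 hWc (L.mem_of_pencil h.mem hW) hq hpq).symm
  have hwq : ¬ L.Par w q := fun hwq => hpw (L.par_equiv.trans hpq (L.par_equiv.symm hwq))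
  obtain ⟨D, ⟨hD, -, hWD⟩, -⟩ := L.touching W hWc w hwW q hqW hwq
  have hwD : w ∈ D := (hWD.symm.subset rfl : w ∈ W ∩ D).2
  have h1 : σ w ∈ W := hcirc W hWc ▸ ⟨w, hwW, rfl⟩
  have h2 : σ w ∈ D := hcirc D hD ▸ ⟨w, hwD, rfl⟩
  exact hWD.subset ⟨h1, h2⟩

theorem exists_fix_map_eq (h : L.PencilGroup p K Δ) {N : Set P} (hN : N ∈ L.pencil p K)
    {r x y : P} (hr : r ∈ N) (hrp : r ≠ p) (hx : x ∈ N) (hxp : x ≠ p) (hxr : x ≠ r)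
    (hy : y ∈ N) (hyp : y ≠ p) (hyr : y ≠ r) : ∃ σ ∈ Δ, σ r = r ∧ σ x = y := by
  have hpr := h.not_par_of_mem hN hr hrp
  obtain ⟨t, ⟨hrt, htK⟩, -⟩ := L.parPoint r K h.circle
  have hpt : ¬ L.Par p t := fun hpt => hpr (L.par_equiv.trans hpt (L.par_equiv.symm hrt))
  have htp : t ≠ p := by rintro rfl; exact hpt (L.par_equiv.refl t)
  obtain ⟨τ, hτ, hτr⟩ := h.trans r t hpr hpt
  have hτN : ⇑τ '' N = K := L.pencil_eq_of_mem h.circle h.mem htp (h.pen τ hτ N hN)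
    (Or.inl rfl) ⟨r, hr, hτr⟩ htK
  have hK : ∀ z ∈ N, τ z ∈ K := fun z hz => hτN ▸ ⟨z, hz, rfl⟩
  have hne : ∀ z, z ≠ r → τ z ≠ t := fun z hz => hτr ▸ τ.injective.ne hz
  obtain ⟨σ, hσ, hσt, hσx⟩ := h.trans₂ t htK htp (τ x) (hK x hx) (h.map_ne hτ hxp) (hne x hxr)
    (τ y) (hK y hy) (h.map_ne hτ hyp) (hne y hyr)
  refine ⟨τ⁻¹ * σ * τ, Δ.mul_mem (Δ.mul_mem (Δ.inv_mem hτ) hσ) hτ, ?_, ?_⟩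
  · simp only [Equiv.Perm.mul_apply, hτr, hσt, Equiv.Perm.inv_eq_iff_eq]
  · simp only [Equiv.Perm.mul_apply, hσx, Equiv.Perm.inv_eq_iff_eq]

/-- If `M` touches a pencil circle at `z` and meets another one in `x ≠ y`, then an involution in
the stabilizer of `z` swaps `x` and `y`. -/
theorem exists_involution_swap (h : L.PencilGroup p K Δ) {N M R : Set P}
    (hN : N ∈ L.pencil p K) (hM : M ∈ L.Circles) (hR : R ∈ L.pencil p K) (hpM : p ∉ M) {z x y : P}
    (hMN : M ∩ N = {z}) (hxM : x ∈ M) (hyM : y ∈ M) (hxR : x ∈ R) (hyR : y ∈ R) (hxy : x ≠ y) :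
    ∃ σ ∈ Δ, σ ≠ 1 ∧ σ * σ = 1 ∧ σ z = z ∧ σ x = y ∧ ⇑σ '' R = R := by
  have hNc := L.circle_mem_of_pencil h.circle hN
  have hRc := L.circle_mem_of_pencil h.circle hR
  have ne_p : ∀ {u}, u ∈ M → u ≠ p := fun hu hup => hpM (hup ▸ hu)
  have hz : z ∈ M ∩ N := hMN ▸ Set.mem_singleton z
  have hne : N ≠ R := by
    rintro rfl
    exact hxy ((hMN.subset ⟨hxM, hxR⟩ : x = z).trans (hMN.subset ⟨hyM, hyR⟩ : y = z).symm)
  have ne_z : ∀ {u}, u ∈ R → u ≠ z := by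
    rintro u hu rfl
    exact hne (L.pencil_eq_of_mem h.circle h.mem (ne_p hz.1) hN hR hz.2 hu)
  have proj : ∀ {u}, u ∈ M → u ∈ R → ∃ v ∈ N, L.Par u v ∧ v ≠ p ∧ v ≠ z := by
    intro u huM huR
    obtain ⟨v, ⟨huv, hv⟩, -⟩ := L.parPoint u N hNc
    refine ⟨v, hv, huv, ?_, ?_⟩ <;> rintro rfl
    · exact h.not_par_of_mem hR huR (ne_p huM) (L.par_equiv.symm huv)
    · exact L.not_par hM huM hz.1 (ne_z huR) huv
  obtain ⟨x', hx', hxx', hx'p, hx'z⟩ := proj hxM hxR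
  obtain ⟨y', hy', hyy', hy'p, hy'z⟩ := proj hyM hyR
  obtain ⟨σ, hσ, hσz, hσx'⟩ := h.exists_fix_map_eq hN hz.2 (ne_p hz.1) hx' hx'p hx'z hy' hy'p hy'z
  have hσM := h.image_eq_of_tangent hσ hN hM (ne_p hz.1) (by rw [Set.inter_comm, hMN]) hσz
  have hσx : σ x = y := by
    have h1 : L.Par (σ x) (σ x') := ((h.aut σ hσ).2 x x').1 hxx'
    rw [hσx'] at h1
    exact L.eq_of_par_s8 hM (hσM ▸ ⟨x, hxM, rfl⟩) hyM
      (L.par_equiv.trans h1 (L.par_equiv.symm hyy'))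
  have hσR := h.image_eq hσ hR hxR (ne_p hxM) (hσx.symm ▸ hyR)
  have hσy : σ y = x := by
    have h1 : σ y ∈ M := hσM ▸ ⟨y, hyM, rfl⟩
    have h2 : σ y ∈ R := hσR ▸ ⟨y, hyR, rfl⟩
    have h3 : σ y ≠ y := fun h3 => hxy (σ.injective (hσx.trans h3.symm))
    by_contra h4
    have hMR : M = R := (L.joinCircle (σ y) y x (L.not_par hM h1 hyM h3)
      (L.not_par hM hyM hxM hxy.symm) (L.not_par hM h1 hxM h4)).unique
        ⟨hM, h1, hyM, hxM⟩ ⟨hRc, h2, hyR, hxR⟩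
    exact hpM (hMR ▸ L.mem_of_pencil h.mem hR)
  refine ⟨σ, hσ, ?_, ?_, hσz, hσx, hσR⟩
  · rintro rfl
    exact hxy hσx
  · refine h.eq_one_of_fix (Δ.mul_mem hσ hσ) (h.not_par_of_mem hN hz.2 (ne_p hz.1))
      (h.not_par_of_mem hR hxR (ne_p hxM)) (L.not_par hM hz.1 hxM (ne_z hxR).symm) ?_ ?_
    · simp only [Equiv.Perm.mul_apply, hσz]
    · simp only [Equiv.Perm.mul_apply, hσx, hσy]

/-- The stabilizer in `Δ` of a point off `p̄` contains at most one involution. -/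
theorem involution_unique (h : L.PencilGroup p K Δ) {N : Set P} (hN : N ∈ L.pencil p K)
    {x y : P} (hx : x ∈ N) (hxp : x ≠ p) (hy : y ∈ N) (hyp : y ≠ p) (hxy : x ≠ y)
    {i j : Equiv.Perm P} (hi : i ∈ Δ) (hj : j ∈ Δ) (hi₁ : i ≠ 1) (hj₁ : j ≠ 1)
    (hii : i * i = 1) (hjj : j * j = 1) (hiy : i y = y) (hjy : j y = y) : i = j := by
  have free : ∀ {σ : Equiv.Perm P}, σ ∈ Δ → ∀ {r s : P}, r ∈ N → s ∈ N → r ≠ p → s ≠ p →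
      r ≠ s → σ r = r → σ s = s → σ = 1 := fun hσ _ _ hr hs hrp hsp hrs =>
    h.eq_one_of_fix hσ (h.not_par_of_mem hN hr hrp) (h.not_par_of_mem hN hs hsp)
      (L.not_par (L.circle_mem_of_pencil h.circle hN) hr hs hrs)
  have stable : ∀ {σ : Equiv.Perm P}, σ ∈ Δ → ∀ {u v : P}, u ∈ N → u ≠ p → σ u = u → v ∈ N →
      σ v ∈ N := fun hσ _ v hu hup hσu hv =>
    h.image_eq hσ hN hu hup (hσu.symm ▸ hu) ▸ ⟨v, hv, rfl⟩
  have hix : i x ≠ x := fun e => hi₁ (free hi hx hy hxp hyp hxy e hiy)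
  have hjx : j x ≠ x := fun e => hj₁ (free hj hx hy hxp hyp hxy e hjy)
  have hii' : ∀ w, i (i w) = w := fun w => Equiv.ext_iff.1 hii w
  have hjj' : ∀ w, j (j w) = w := fun w => Equiv.ext_iff.1 hjj w
  have hixN := stable hi hy hyp hiy hx
  have hjxN := stable hj hy hyp hjy hx
  obtain ⟨g, hg, hgx, hgi⟩ := h.exists_fix_map_eq hN hx hxp hixN (h.map_ne hi hxp) hix
    hjxN (h.map_ne hj hxp) hjx
  have hgx' : g⁻¹ x = x := by rw [Equiv.Perm.inv_eq_iff_eq, hgx]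
  have hgi' : g⁻¹ (j x) = i x := by rw [Equiv.Perm.inv_eq_iff_eq, hgi]
  have hconj : j * (g * i * g⁻¹) = 1 := by
    refine free (Δ.mul_mem hj (Δ.mul_mem (Δ.mul_mem hg hi) (Δ.inv_mem hg))) hx hjxN hxp
      (h.map_ne hj hxp) hjx.symm ?_ ?_
    · simp only [Equiv.Perm.mul_apply, hgx', hgi, hjj']
    · simp only [Equiv.Perm.mul_apply, hgi', hii', hgx]
  have hjgy : j (g y) = g y := by
    have := Equiv.ext_iff.1 hconj (g y)
    have hinv : g⁻¹ (g y) = y := Equiv.Perm.inv_eq_iff_eq.2 rfl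
    simpa only [Equiv.Perm.mul_apply, hinv, hiy, Equiv.Perm.one_apply]
      using this
  have hgy : g y = y := by
    by_contra hne
    exact hj₁ (free hj (stable hg hx hxp hgx hy) hy (h.map_ne hg hyp) hyp hne hjgy hjy)
  have hg₁ : g = 1 := free hg hx hy hxp hyp hxy hgx hgy
  subst hg₁
  have hji : j * i = 1 := by simpa using hconj
  rw [← mul_left_cancel_iff (a := j), hji, hjj]

/-- Under (A3), an involution in `Δ` with a fixed point off `p̄` fixes every circle of the
pencil. -/
theorem image_eq_of_involution (h : L.PencilGroup p K Δ)
    (hA3 : ∀ M ∈ L.Circles, p ∉ M → ∃! N, N ∈ L.pencil p K ∧ ∃ z, M ∩ N = {z})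
    {σ : Equiv.Perm P} (hσ : σ ∈ Δ) (hσ₁ : σ ≠ 1) (hσσ : σ * σ = 1) {z x : P}
    (hpz : ¬ L.Par p z) (hpx : ¬ L.Par p x) (hzx : ¬ L.Par z x) (hσz : σ z = z)
    {W : Set P} (hW : W ∈ L.pencil p K) : ⇑σ '' W = W := by
  obtain ⟨N, hN, hzN⟩ := L.exists_pencil_mem h.circle h.mem hpz
  have hNc := L.circle_mem_of_pencil h.circle hN
  have hzp : z ≠ p := by rintro rfl; exact hpz (L.par_equiv.refl z)
  by_cases hWN : W = N
  · subst hWN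
    exact h.image_eq hσ hW hzN hzp (hσz.symm ▸ hzN)
  have hxne : ∀ {v : P}, L.Par x v → v ≠ p ∧ v ≠ z ∧ ¬ L.Par z v := by
    intro v hxv
    refine ⟨?_, ?_, fun hzv => hzx (L.par_equiv.trans hzv (L.par_equiv.symm hxv))⟩ <;> rintro rfl
    exacts [hpx (L.par_equiv.symm hxv), hzx (L.par_equiv.symm hxv)]
  obtain ⟨v, ⟨hxv, hvW⟩, -⟩ := L.parPoint x W (L.circle_mem_of_pencil h.circle hW)
  obtain ⟨u, ⟨hxu, huN⟩, -⟩ := L.parPoint x N hNc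
  have hvN : v ∉ N := fun hvN =>
    hWN (L.pencil_eq_of_mem h.circle h.mem (hxne hxv).1 hW hN hvW hvN)
  obtain ⟨M, ⟨hM, hvM, hNM⟩, -⟩ := L.touching N hNc z hzN v hvN (hxne hxv).2.2
  have hpM : p ∉ M := fun hpM => hzp (hNM.subset ⟨L.mem_of_pencil h.mem hN, hpM⟩ : p = z).symm
  have hMN : M ∩ N = {z} := by rw [Set.inter_comm, hNM]
  obtain ⟨w, ⟨hwM, hwW⟩, hwv⟩ : ∃ w ∈ M ∩ W, w ≠ v := by
    by_contra! hall
    refine hWN ((hA3 M hM hpM).unique ⟨hW, v, ?_⟩ ⟨hN, z, hMN⟩)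
    exact Set.eq_singleton_iff_unique_mem.2 ⟨⟨hvM, hvW⟩, hall⟩
  obtain ⟨τ, hτ, hτ₁, hττ, hτz, -, hτW⟩ :=
    h.exists_involution_swap hN hM hW hpM hMN hvM hwM hvW hwW hwv.symm
  rwa [h.involution_unique hN huN (hxne hxu).1 hzN hzp (hxne hxu).2.1 hσ hτ hσ₁ hτ₁ hσσ hττ
    hσz hτz]

end PencilGroup

end LaguerrePlane

/-- assume (A3).  For every circle R ∈ ⟨p,K⟩ and all distinct
x, y ∈ R ∖ {p} there are a point r ∈ R and an involution φ ∈ Δ fixing r̄ and p̄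
pointwise, mapping K onto itself, with φ(x) = y. -/
theorem symmetry_swapping_points
    {P : Type*} (L : LaguerrePlane P) (p : P) (K : Set P)
    (Δ : Subgroup (Equiv.Perm P))
    (hK : K ∈ L.Circles) (hpK : p ∈ K)
    (haut : ∀ σ ∈ Δ, L.IsAut σ)
    (hfix : ∀ σ ∈ Δ, ∀ q, L.Par p q → σ q = q)
    (hpen : ∀ σ ∈ Δ, ∀ M ∈ L.pencil p K, ⇑σ '' M ∈ L.pencil p K)
    (hA1 : ∀ x y : P, ¬ L.Par p x → ¬ L.Par p y → ∃ σ ∈ Δ, σ x = y)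
    (hA2 : ∀ r ∈ K, r ≠ p → ∀ x ∈ K, x ≠ p → x ≠ r → ∀ y ∈ K, y ≠ p → y ≠ r →
      ∃ σ ∈ Δ, σ r = r ∧ σ x = y)    (hA3 : ∀ M ∈ L.Circles, p ∉ M → ∃! N, N ∈ L.pencil p K ∧ ∃ z, M ∩ N = {z})    :
    ∀ R ∈ L.pencil p K, ∀ x ∈ R, ∀ y ∈ R, x ≠ p → y ≠ p → x ≠ y →
    ∃ r ∈ R, ∃ φ ∈ Δ, φ ≠ 1 ∧ φ * φ = 1 ∧
      (∀ q, L.Par r q → φ q = q) ∧ (∀ q, L.Par p q → φ q = q) ∧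
      ⇑φ '' K = K ∧ φ x = y := by
  intro R hR x hxR y hyR hxp hyp hxy
  have hRc := L.circle_mem_of_pencil hK hR
  have hpR := L.mem_of_pencil hpK hR
  obtain ⟨q, hpq, hqp⟩ := L.exists_par_ne hRc hpR hxR hyR hxp hyp hxy
  have h : L.PencilGroup p K Δ := ⟨hK, hpK, haut, hfix, hpen, hA1, hA2, q, hpq, hqp⟩
  have hq : ∀ {u}, u ∈ R → u ≠ p → ¬ L.Par u q := fun hu hup huq =>
    h.not_par_of_mem hR hu hup (L.par_equiv.trans hpq (L.par_equiv.symm huq))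
  obtain ⟨M, ⟨hM, hxM, hyM, hqM⟩, -⟩ :=
    L.joinCircle x y q (L.not_par hRc hxR hyR hxy) (hq hyR hyp) (hq hxR hxp)
  have hpM : p ∉ M := fun hpM => hqp (L.eq_of_par_s8 hM hpM hqM hpq).symm
  obtain ⟨N, ⟨hN, z, hMN⟩, -⟩ := hA3 M hM hpM
  have hz : z ∈ M ∩ N := hMN ▸ Set.mem_singleton z
  have hzp : z ≠ p := fun e => hpM (e ▸ hz.1)
  have hpz := h.not_par_of_mem hN hz.2 hzp
  have hzx : z ≠ x := by
    rintro rfl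
    obtain rfl := L.pencil_eq_of_mem hK hpK hzp hN hR hz.2 hxR
    exact hxy (hMN.subset ⟨hyM, hyR⟩ : y = z).symm
  obtain ⟨φ, hφ, hφ₁, hφφ, hφz, hφx, -⟩ :=
    h.exists_involution_swap hN hM hR hpM hMN hxM hyM hxR hyR hxy
  have hpen_fix : ∀ W ∈ L.pencil p K, ⇑φ '' W = W := fun W hW =>
    h.image_eq_of_involution hA3 hφ hφ₁ hφφ hpz (h.not_par_of_mem hR hxR hxp)
      (L.not_par hM hz.1 hxM hzx) hφz hW
  obtain ⟨r, ⟨hzr, hrR⟩, -⟩ := L.parPoint z R hRc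
  refine ⟨r, hrR, φ, hφ, hφ₁, hφφ, fun w hrw => ?_, hfix φ hφ, hpen_fix K (Or.inl rfl), hφx⟩
  have hzw := L.par_equiv.trans hzr hrw
  have hpw : ¬ L.Par p w := fun hpw => hpz (L.par_equiv.trans hpw (L.par_equiv.symm hzw))
  obtain ⟨W, hW, hwW⟩ := L.exists_pencil_mem hK hpK hpw
  exact h.fix_of_par hφ (L.circle_mem_of_pencil hK hW) (hpen_fix W hW) hφz hzw hwW
end
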